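/- arXiv:1612.05103 — 2 statements merged into one kernel-verified Lean document; each statement's English description precedes it below -/
import Mathlib

section
/- Let 0 < γ < 1 and λ ∈ ℝ, and let s > 0 be a real number with s^γ > λ. Then the function t ↦ e^{−st} E_γ(λ t^γ) is integrable on (0, ∞) and ∫_0^∞ e^{−st} E_γ(λ t^γ) dt = s^{γ−1} / (s^γ − λ), where E_γ denotes the Mittag-Leffler function. -/
open MeasureTheory Set
open scoped ENNReal

/-- The Mittag-Leffler function `E_γ(z) = Σ_{n=0}^∞ z^n / Γ(γ n + 1)`. -/
noncomputable def mittagLeffler (γ z : ℝ) : ℝ :=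
  ∑' n : ℕ, z ^ n / Real.Gamma (γ * n + 1)

lemma ml_gamma_lower {a M : ℝ} (ha : 0 ≤ a) (hM : 0 < M) :
    Real.exp (-M) * M ^ a ≤ Real.Gamma (a + 1) := by
  have h1 : (0:ℝ) < a + 1 := by linarith
  have hc := Real.GammaIntegral_convergent h1
  rw [Real.Gamma_eq_integral h1]
  have hsub : Ioi M ⊆ Ioi (0:ℝ) := Ioi_subset_Ioi hM.le
  calc Real.exp (-M) * M ^ a = ∫ x in Ioi M, Real.exp (-x) * M ^ a := by
        rw [integral_mul_const, integral_exp_neg_Ioi]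
    _ ≤ ∫ x in Ioi M, Real.exp (-x) * x ^ (a + 1 - 1) := by
        apply setIntegral_mono_on
        · exact (integrableOn_exp_neg_Ioi M).mul_const _
        · exact hc.mono_set hsub
        · exact measurableSet_Ioi
        · intro x hx
          have hx' : M < x := hx
          rw [add_sub_cancel_right]
          gcongr
    _ ≤ ∫ x in Ioi 0, Real.exp (-x) * x ^ (a + 1 - 1) := by
        apply setIntegral_mono_set hc
        · filter_upwards [ae_restrict_mem measurableSet_Ioi] with x hx
          have hx' : (0:ℝ) < x := hx
          simp only [Pi.zero_apply]
          positivity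
        · exact hsub.eventuallyLE

lemma ml_gamma_pos {γ : ℝ} (hγ0 : 0 < γ) (n : ℕ) : 0 < Real.Gamma (γ * n + 1) :=
  Real.Gamma_pos_of_pos (by positivity)

lemma ml_summable_nonneg {γ : ℝ} (hγ0 : 0 < γ) {x : ℝ} (hx : 0 ≤ x) :
    Summable (fun n : ℕ => x ^ n / Real.Gamma (γ * n + 1)) := by
  set M : ℝ := (2 * x + 1) ^ (γ⁻¹) with hMdef
  have hM : 0 < M := by positivity
  have hMγ : M ^ γ = 2 * x + 1 := by
    rw [hMdef, Real.rpow_inv_rpow (by positivity) hγ0.ne']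
  have hr : x / (2 * x + 1) < 1 := by rw [div_lt_one (by positivity)]; linarith
  refine Summable.of_nonneg_of_le (fun n => ?_) (fun n => ?_)
    ((summable_geometric_of_lt_one (by positivity) hr).mul_left (Real.exp M))
  · have := ml_gamma_pos hγ0 n
    positivity
  · have h := ml_gamma_lower (a := γ * n) (by positivity) hM
    rw [Real.rpow_mul hM.le, hMγ, Real.rpow_natCast] at h
    rw [div_le_iff₀ (ml_gamma_pos hγ0 n), div_pow]
    have h3 : Real.exp M * Real.exp (-M) = 1 := by rw [← Real.exp_add]; simp
    calc x ^ n = Real.exp M * (x ^ n / (2 * x + 1) ^ n) * (Real.exp (-M) * (2 * x + 1) ^ n) := by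
          have : (2 * x + 1) ^ n ≠ 0 := by positivity
          field_simp
          linear_combination (-x ^ n) * h3
      _ ≤ _ := by gcongr

lemma ml_summable {γ : ℝ} (hγ0 : 0 < γ) (x : ℝ) :
    Summable (fun n : ℕ => x ^ n / Real.Gamma (γ * n + 1)) := by
  apply Summable.of_norm
  refine (ml_summable_nonneg hγ0 (abs_nonneg x)).congr (fun n => ?_)
  rw [norm_div, norm_pow, Real.norm_eq_abs, Real.norm_of_nonneg (ml_gamma_pos hγ0 n).le]

lemma ml_continuous {γ : ℝ} (hγ0 : 0 < γ) : Continuous (mittagLeffler γ) := by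
  rw [continuous_iff_continuousAt]
  intro z
  have : ContinuousOn (mittagLeffler γ) (Metric.ball 0 (|z| + 1)) := by
    unfold mittagLeffler
    refine continuousOn_tsum (u := fun n : ℕ => (|z| + 1) ^ n / Real.Gamma (γ * n + 1))
      (fun n => ?_) (ml_summable hγ0 _) (fun n y hy => ?_)
    · fun_prop
    · have hy' : |y| < |z| + 1 := by simpa using hy
      have := ml_gamma_pos hγ0 n
      rw [norm_div, norm_pow, Real.norm_eq_abs, Real.norm_of_nonneg this.le]
      gcongr
  exact this.continuousAt (Metric.isOpen_ball.mem_nhds (by simp))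

/-- Termwise Laplace transform. -/
lemma ml_laplace_nonneg {γ : ℝ} (hγ0 : 0 < γ) {lam : ℝ} (hlam : 0 ≤ lam)
    {s : ℝ} (hs : 0 < s) (hslam : lam < s ^ γ) :
    ∫ t in Ioi (0:ℝ), Real.exp (-s * t) * mittagLeffler γ (lam * t ^ γ) =
      s ^ (γ - 1) / (s ^ γ - lam) := by
  set F : ℕ → ℝ → ℝ := fun n t =>
    Real.exp (-s * t) * ((lam * t ^ γ) ^ n / Real.Gamma (γ * n + 1)) with hF
  have hFeq : ∀ n, ∀ t ∈ Ioi (0:ℝ), F n t =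
      (lam ^ n / Real.Gamma (γ * n + 1)) * (t ^ ((γ * n + 1) - 1) * Real.exp (-(s * t))) := by
    intro n t ht
    have ht' : (0:ℝ) < t := ht
    simp only [hF]
    rw [mul_pow, add_sub_cancel_right, Real.rpow_mul ht'.le, Real.rpow_natCast, neg_mul]
    ring
  have hsγ : 0 < s ^ γ := by positivity
  have hFint : ∀ n, ∫ t in Ioi (0:ℝ), F n t = (1 / s) * (lam / s ^ γ) ^ n := by
    intro n
    rw [setIntegral_congr_fun measurableSet_Ioi (hFeq n), integral_const_mul,
      Real.integral_rpow_mul_exp_neg_mul_Ioi (by positivity) hs]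
    have := (ml_gamma_pos hγ0 n).ne'
    rw [Real.rpow_add (by positivity), Real.rpow_one, Real.rpow_mul (by positivity),
      Real.rpow_natCast, Real.div_rpow zero_le_one hs.le, Real.one_rpow, one_div_pow, div_pow]
    field_simp
  have hFi : ∀ n, Integrable (F n) (volume.restrict (Ioi 0)) := by
    intro n
    rcases hlam.eq_or_lt with h0 | h0
    · rcases n with _ | n
      · apply not_imp_comm.1 integral_undef
        rw [hFint]; simp [hs.ne']
      · have : F (n+1) = fun _ => 0 := by
          funext t; simp [hF, ← h0]
        rw [this]; exact integrable_zero _ _ _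
    · apply not_imp_comm.1 integral_undef
      rw [hFint]; positivity
  have hnorm : ∀ n, ∫ t in Ioi (0:ℝ), ‖F n t‖ = (1 / s) * (lam / s ^ γ) ^ n := by
    intro n
    rw [← hFint]
    apply setIntegral_congr_fun measurableSet_Ioi
    intro t ht
    have ht' : (0:ℝ) < t := ht
    have := ml_gamma_pos hγ0 n
    apply Real.norm_of_nonneg
    simp only [hF]; positivity
  have hr : lam / s ^ γ < 1 := by rwa [div_lt_one hsγ]
  have hr0 : 0 ≤ lam / s ^ γ := by positivity
  have hg := (hasSum_geometric_of_lt_one hr0 hr).mul_left (1 / s)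
  have key := hasSum_integral_of_summable_integral_norm hFi
    (by simp_rw [hnorm]; exact hg.summable)
  simp_rw [hFint] at key
  have h2 := key.unique hg
  have h3 : ∀ t, ∑' n, F n t = Real.exp (-s * t) * mittagLeffler γ (lam * t ^ γ) := by
    intro t; simp only [hF, mittagLeffler]; rw [tsum_mul_left]
  simp_rw [h3] at h2
  rw [h2, Real.rpow_sub hs, Real.rpow_one]
  have : s ^ γ - lam ≠ 0 := by linarith
  field_simp

lemma ml_beta {a b t : ℝ} (ha : 0 < a) (hb : 0 < b) (ht : 0 < t) :
    ∫ r in (0:ℝ)..t, (t - r) ^ (a - 1) * r ^ (b - 1) =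
      t ^ (a + b - 1) * (Real.Gamma a * Real.Gamma b / Real.Gamma (a + b)) := by
  have h1 := Complex.betaIntegral_scaled (b:ℂ) (a:ℂ) ht
  have h2 := Complex.Gamma_mul_Gamma_eq_betaIntegral (s := (b:ℂ)) (t := (a:ℂ)) (by simpa) (by simpa)
  have h3 : Complex.betaIntegral b a = ((Real.Gamma a * Real.Gamma b / Real.Gamma (a + b) : ℝ) : ℂ) := by
    have hne : ((Real.Gamma (a + b) : ℝ) : ℂ) ≠ 0 := by
      exact_mod_cast (Real.Gamma_pos_of_pos (by linarith)).ne'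
    push_cast
    rw [eq_div_iff hne]
    rw [← Complex.ofReal_add, Complex.Gamma_ofReal, Complex.Gamma_ofReal, Complex.Gamma_ofReal,
      add_comm b a] at h2
    rw [mul_comm, ← h2, mul_comm]
  rw [← Complex.ofReal_inj, ← intervalIntegral.integral_ofReal, Complex.ofReal_mul, ← h3,
    Complex.ofReal_cpow ht.le]
  push_cast
  rw [add_comm (a:ℂ) b, ← h1]
  apply intervalIntegral.integral_congr
  intro r hr
  rw [uIcc_of_le ht.le] at hr
  simp only
  rw [Complex.ofReal_cpow (sub_nonneg.2 hr.2), Complex.ofReal_cpow hr.1]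
  push_cast
  ring

lemma ml_kernel_intervalIntegrable {γ t : ℝ} (hγ0 : 0 < γ) :
    IntervalIntegrable (fun r => (t - r) ^ (γ - 1)) volume 0 t := by
  have h := (intervalIntegral.intervalIntegrable_rpow' (a := t) (b := 0) (r := γ - 1)
    (by linarith)).comp_sub_left t
  simpa using h

/-- Volterra equation. -/
lemma ml_volterra {γ : ℝ} (hγ0 : 0 < γ) (lam : ℝ) {t : ℝ} (ht : 0 < t) :
    mittagLeffler γ (lam * t ^ γ) = 1 + lam / Real.Gamma γ *
      ∫ r in (0:ℝ)..t, (t - r) ^ (γ - 1) * mittagLeffler γ (lam * r ^ γ) := by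
  set F : ℕ → ℝ → ℝ := fun n r =>
    (t - r) ^ (γ - 1) * ((lam * r ^ γ) ^ n / Real.Gamma (γ * n + 1)) with hF
  have hGγ : 0 < Real.Gamma γ := Real.Gamma_pos_of_pos hγ0
  have hFi : ∀ n, Integrable (F n) (volume.restrict (Ioc 0 t)) := by
    intro n
    have : IntervalIntegrable (F n) volume 0 t := by
      apply (ml_kernel_intervalIntegrable hγ0).mul_continuousOn
      apply Continuous.continuousOn
      have := Real.continuous_rpow_const hγ0.le
      fun_prop
    exact (intervalIntegrable_iff_integrableOn_Ioc_of_le ht.le).1 this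
  have hbase : ∀ (c : ℝ) (n : ℕ), ∫ r in Ioc 0 t,
      (t - r) ^ (γ - 1) * ((c * r ^ γ) ^ n / Real.Gamma (γ * n + 1)) =
      Real.Gamma γ * t ^ γ * ((c * t ^ γ) ^ n / Real.Gamma (γ * (n + 1 : ℕ) + 1)) := by
    intro c n
    have hn := (ml_gamma_pos hγ0 n).ne'
    have e : ∀ r ∈ Ioc 0 t, (t - r) ^ (γ - 1) * ((c * r ^ γ) ^ n / Real.Gamma (γ * n + 1)) =
        (c ^ n / Real.Gamma (γ * n + 1)) * ((t - r) ^ (γ - 1) * r ^ ((γ * n + 1) - 1)) := by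
      intro r hr
      rw [mul_pow, add_sub_cancel_right, Real.rpow_mul hr.1.le, Real.rpow_natCast]
      ring
    rw [setIntegral_congr_fun measurableSet_Ioc e, integral_const_mul,
      ← intervalIntegral.integral_of_le ht.le, ml_beta hγ0 (by positivity) ht]
    have e1 : γ + (γ * n + 1) - 1 = γ + γ * n := by ring
    have e2 : γ + (γ * n + 1) = γ * (n + 1 : ℕ) + 1 := by push_cast; ring
    rw [e1, e2, Real.rpow_add ht, Real.rpow_mul ht.le, Real.rpow_natCast, mul_pow]
    field_simp
  have hnorm : ∀ n, ∫ r in Ioc 0 t, ‖F n r‖ =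
      Real.Gamma γ * t ^ γ * ((|lam| * t ^ γ) ^ n / Real.Gamma (γ * (n + 1 : ℕ) + 1)) := by
    intro n
    rw [← hbase]
    apply setIntegral_congr_fun measurableSet_Ioc
    intro r hr
    have h1 : 0 ≤ (t - r) ^ (γ - 1) := Real.rpow_nonneg (sub_nonneg.2 hr.2) _
    have h2 : 0 ≤ r ^ γ := Real.rpow_nonneg hr.1.le _
    simp only [hF]
    rw [norm_mul, norm_div, norm_pow, norm_mul, Real.norm_of_nonneg h1, Real.norm_of_nonneg h2,
      Real.norm_of_nonneg (ml_gamma_pos hγ0 n).le, Real.norm_eq_abs]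
  have hshift : ∀ x : ℝ, Summable
      (fun n : ℕ => x ^ n / Real.Gamma (γ * (n + 1 : ℕ) + 1)) := by
    intro x
    by_cases hx : x = 0
    · apply summable_of_ne_finset_zero (s := {0})
      intro n hn
      simp at hn
      simp [hx, hn]
    · have h := (summable_nat_add_iff 1).2 (ml_summable hγ0 x)
      refine (h.mul_left x⁻¹).congr (fun n => ?_)
      rw [pow_succ]
      field_simp
  have key := hasSum_integral_of_summable_integral_norm hFi
    (by simp_rw [hnorm]; exact (hshift _).mul_left _)
  have h3 : ∀ r, ∑' n, F n r = (t - r) ^ (γ - 1) * mittagLeffler γ (lam * r ^ γ) := by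
    intro r; simp only [hF, mittagLeffler]; rw [tsum_mul_left]
  simp_rw [h3] at key
  rw [intervalIntegral.integral_of_le ht.le, ← key.tsum_eq]
  simp only [hF, hbase]
  rw [tsum_mul_left, mittagLeffler, (ml_summable hγ0 _).tsum_eq_zero_add]
  have e : ∀ n : ℕ, (lam * t ^ γ) ^ (n + 1) / Real.Gamma (γ * (n + 1 : ℕ) + 1) =
      (lam * t ^ γ) * ((lam * t ^ γ) ^ n / Real.Gamma (γ * (n + 1 : ℕ) + 1)) := by
    intro n; rw [pow_succ]; ring
  simp_rw [e]
  rw [tsum_mul_left]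
  simp
  field_simp

noncomputable def mlK (a y : ℝ) : ℝ := if 0 < y then y ^ (a - 1) else 0

lemma mlK_nonneg (a y : ℝ) : 0 ≤ mlK a y := by
  unfold mlK; split_ifs with h
  · positivity
  · exact le_rfl

lemma mlK_measurable (a : ℝ) : Measurable (mlK a) := by
  unfold mlK
  exact Measurable.ite measurableSet_Ioi (by fun_prop) measurable_const

lemma mlK_mul (a c y : ℝ) (hc : 0 < c) : mlK a (c * y) = c ^ (a - 1) * mlK a y := by
  unfold mlK
  by_cases h : 0 < y
  · have : 0 < c * y := by positivity
    rw [if_pos h, if_pos this, Real.mul_rpow hc.le h.le]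
  · have : ¬ 0 < c * y := by
      rw [mul_pos_iff_of_pos_left hc]; exact h
    rw [if_neg h, if_neg this, mul_zero]

noncomputable def mlPhi (a y : ℝ) : ℝ := mlK a y * mlK a (1 + y)

lemma mlPhi_nonneg (a y : ℝ) : 0 ≤ mlPhi a y :=
  mul_nonneg (mlK_nonneg _ _) (mlK_nonneg _ _)

lemma mlPhi_integrable {a : ℝ} (ha : 0 < a) (ha1 : a < 1 / 2) : Integrable (mlPhi a) := by
  have hm : Measurable (mlPhi a) :=
    (mlK_measurable a).mul ((mlK_measurable a).comp (measurable_const.add measurable_id))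
  have h1 : IntegrableOn (mlPhi a) (Ioc 0 1) := by
    have hi : IntegrableOn (fun y : ℝ => y ^ (a - 1)) (Ioc 0 1) :=
      (intervalIntegrable_iff_integrableOn_Ioc_of_le zero_le_one).1
        (intervalIntegral.intervalIntegrable_rpow' (by linarith))
    refine Integrable.mono' hi hm.aestronglyMeasurable ?_
    filter_upwards [ae_restrict_mem measurableSet_Ioc] with y hy
    have hy0 : 0 < y := hy.1
    have hy1 : 0 < 1 + y := by linarith
    rw [Real.norm_of_nonneg (mlPhi_nonneg a y)]
    unfold mlPhi mlK
    rw [if_pos hy0, if_pos hy1]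
    have : (1 + y) ^ (a - 1) ≤ 1 := Real.rpow_le_one_of_one_le_of_nonpos (by linarith) (by linarith)
    exact mul_le_of_le_one_right (by positivity) this
  have h2 : IntegrableOn (mlPhi a) (Ioi 1) := by
    have hi : IntegrableOn (fun y : ℝ => y ^ (2 * a - 2)) (Ioi 1) :=
      integrableOn_Ioi_rpow_of_lt (by linarith) zero_lt_one
    refine Integrable.mono' hi hm.aestronglyMeasurable ?_
    filter_upwards [ae_restrict_mem measurableSet_Ioi] with y hy
    have hy' : (1:ℝ) < y := hy
    have hy0 : 0 < y := by linarith
    have hy1 : 0 < 1 + y := by linarith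
    rw [Real.norm_of_nonneg (mlPhi_nonneg a y)]
    unfold mlPhi mlK
    rw [if_pos hy0, if_pos hy1, show 2 * a - 2 = (a - 1) + (a - 1) by ring, Real.rpow_add hy0]
    gcongr ?_ * ?_
    exact Real.rpow_le_rpow_of_nonpos hy0 (by linarith) (by linarith)
  have h3 : IntegrableOn (mlPhi a) (Ioi 0) := by
    rw [← Ioc_union_Ioi_eq_Ioi zero_le_one]
    exact h1.union h2
  have h4 : (Ioi (0:ℝ)).indicator (mlPhi a) = mlPhi a := by
    apply indicator_eq_self.2
    intro y hy
    by_contra hn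
    apply hy
    have : ¬ 0 < y := hn
    simp [mlPhi, mlK, this]
  rw [← h4]
  exact h3.integrable_indicator measurableSet_Ioi

lemma mlPhi_integral_pos {a : ℝ} (ha : 0 < a) (ha1 : a < 1 / 2) : 0 < ∫ y, mlPhi a y := by
  rw [integral_pos_iff_support_of_nonneg
    (fun y => mlPhi_nonneg a y) (mlPhi_integrable ha ha1)]
  have : Ioi (0:ℝ) ⊆ Function.support (mlPhi a) := by
    intro y hy
    have hy0 : (0:ℝ) < y := hy
    have hy1 : 0 < 1 + y := by linarith
    rw [Function.mem_support]
    unfold mlPhi mlK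
    rw [if_pos hy0, if_pos hy1]
    positivity
  exact lt_of_lt_of_le (by simp) (measure_mono this)

lemma mlK_conv_lt {a : ℝ} (ha : 0 < a) (ha1 : a < 1 / 2) {t r : ℝ} (h : r < t) :
    Integrable (fun x => mlK a (x - t) * mlK a (x - r)) ∧
    ∫ x, mlK a (x - t) * mlK a (x - r) = (∫ y, mlPhi a y) * (t - r) ^ (2 * a - 1) := by
  have hd : 0 < t - r := by linarith
  have e : (fun x => mlK a (x - t) * mlK a (x - r)) =
      fun x => ((t - r) ^ (a - 1) * (t - r) ^ (a - 1)) * mlPhi a ((x - t) / (t - r)) := by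
    funext x
    have e1 : x - t = (t - r) * ((x - t) / (t - r)) := by field_simp
    have e2 : x - r = (t - r) * (1 + (x - t) / (t - r)) := by field_simp; ring
    conv_lhs => rw [e2, e1]
    rw [mlK_mul _ _ _ hd, mul_div_cancel_left₀ _ hd.ne', mlK_mul _ _ _ hd, mlPhi]
    ring
  rw [e]
  refine ⟨?_, ?_⟩
  · exact (((mlPhi_integrable ha ha1).comp_div hd.ne').comp_sub_right t).const_mul _
  · rw [integral_const_mul,
      integral_sub_right_eq_self (fun x => mlPhi a (x / (t - r))) t,
      Measure.integral_comp_div, abs_of_pos hd, smul_eq_mul,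
      show 2 * a - 1 = (a - 1) + (a - 1) + 1 by ring, Real.rpow_add hd, Real.rpow_add hd,
      Real.rpow_one]
    ring

lemma mlK_conv {a : ℝ} (ha : 0 < a) (ha1 : a < 1 / 2) {t r : ℝ} (h : t ≠ r) :
    Integrable (fun x => mlK a (x - t) * mlK a (x - r)) ∧
    ∫ x, mlK a (x - t) * mlK a (x - r) =
      (∫ y, mlPhi a y) * (mlK (2 * a) (t - r) + mlK (2 * a) (r - t)) := by
  rcases lt_or_gt_of_ne h with h | h
  · have := mlK_conv_lt ha ha1 h
    simp_rw [mul_comm (mlK a (_ - r))] at this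
    refine ⟨this.1, this.2.trans ?_⟩
    unfold mlK
    rw [if_neg (by linarith), if_pos (by linarith), zero_add]
  · have := mlK_conv_lt ha ha1 h
    refine ⟨this.1, this.2.trans ?_⟩
    unfold mlK
    rw [if_pos (by linarith), if_neg (by linarith), add_zero]

lemma ml_ae_ne : ∀ᵐ p : ℝ × ℝ ∂(volume.prod volume), p.1 ≠ p.2 := by
  have hmeas : MeasurableSet {p : ℝ × ℝ | p.1 ≠ p.2} :=
    (measurableSet_eq_fun measurable_fst measurable_snd).compl
  rw [Measure.ae_prod_iff_ae_ae hmeas]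
  refine Filter.Eventually.of_forall (fun x => ?_)
  filter_upwards [Measure.ae_ne volume x] with y hy
  exact fun h => hy h.symm

/-- Positivity of the quadratic form of the kernel. -/
lemma ml_quad {γ : ℝ} (hγ0 : 0 < γ) (hγ1 : γ < 1) {u : ℝ → ℝ} (hu : Continuous u)
    {T : ℝ} (hT : 0 < T) :
    (IntervalIntegrable (fun t => u t * ∫ r in (0:ℝ)..t, (t - r) ^ (γ - 1) * u r) volume 0 T) ∧
    0 ≤ ∫ t in (0:ℝ)..T, u t * ∫ r in (0:ℝ)..t, (t - r) ^ (γ - 1) * u r := by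
  set a := γ / 2 with ha_def
  have ha : 0 < a := by positivity
  have ha1 : a < 1 / 2 := by rw [ha_def]; linarith
  have h2a : 2 * a = γ := by rw [ha_def]; ring
  set w : ℝ → ℝ := (Ioc 0 T).indicator u with hw
  have hwm : Measurable w := hu.measurable.indicator measurableSet_Ioc
  have hwi : Integrable w :=
    (hu.integrableOn_Ioc).integrable_indicator measurableSet_Ioc
  obtain ⟨B, hB⟩ : ∃ B, ∀ x, ‖w x‖ ≤ B := by
    obtain ⟨B, hB⟩ := isCompact_Icc.exists_bound_of_continuousOn (s := Icc 0 T) hu.continuousOn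
    refine ⟨max B 0, fun x => ?_⟩
    by_cases hx : x ∈ Ioc 0 T
    · rw [hw, indicator_of_mem hx]; exact (hB x (Ioc_subset_Icc_self hx)).trans (le_max_left _ _)
    · rw [hw, indicator_of_notMem hx, norm_zero]; exact le_max_right _ _
  set P : ℝ × ℝ → ℝ := fun p => w p.1 * (w p.2 * mlK γ (p.1 - p.2)) with hP
  have hPi : Integrable P (volume.prod volume) := by
    set k : ℝ → ℝ := (Ioc 0 T).indicator (fun y => y ^ (γ - 1)) with hk
    have hki : Integrable k := by
      refine IntegrableOn.integrable_indicator ?_ measurableSet_Ioc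
      exact (intervalIntegrable_iff_integrableOn_Ioc_of_le hT.le).1
        (intervalIntegral.intervalIntegrable_rpow' (by linarith))
    have h := Integrable.convolution_integrand (ContinuousLinearMap.mul ℝ ℝ) hwi hki
    simp only [ContinuousLinearMap.mul_apply'] at h
    have h' := h.bdd_mul (f := fun p => w p.1) (c := B)
      (hwm.comp measurable_fst).aestronglyMeasurable (Filter.Eventually.of_forall fun p => hB _)
    refine h'.congr (Filter.Eventually.of_forall fun p => ?_)
    simp only [hP]
    by_cases h1 : p.1 ∈ Ioc 0 T
    · by_cases h2 : p.2 ∈ Ioc 0 T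
      · congr 2
        rw [hk]
        unfold mlK
        by_cases h3 : 0 < p.1 - p.2
        · rw [if_pos h3, indicator_of_mem]
          exact ⟨h3, by linarith [h1.2, h2.1]⟩
        · rw [if_neg h3, indicator_of_notMem]
          exact fun h => h3 h.1
      · simp [hw, indicator_of_notMem h2]
    · simp [hw, indicator_of_notMem h1]
  have hPs : Integrable (fun p : ℝ × ℝ => P p.swap) (volume.prod volume) := hPi.swap
  set g : (ℝ × ℝ) × ℝ → ℝ := fun q =>
    (w q.1.1 * w q.1.2) * (mlK a (q.2 - q.1.1) * mlK a (q.2 - q.1.2)) with hg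
  have hKm := mlK_measurable a
  have hgm : Measurable g := by
    simp only [hg]
    refine Measurable.mul (by fun_prop) (Measurable.mul (hKm.comp (by fun_prop)) (hKm.comp (by fun_prop)))
  set C := ∫ y, mlPhi a y with hC
  have hCpos : 0 < C := mlPhi_integral_pos ha ha1
  have hgint : ∀ p : ℝ × ℝ, p.1 ≠ p.2 → ∫ x, g (p, x) = C * (P p + P p.swap) := by
    intro p hp
    simp only [hg]
    rw [integral_const_mul, (mlK_conv ha ha1 hp).2, h2a]
    simp only [hP, Prod.fst_swap, Prod.snd_swap]
    ring
  have hgnorm : ∀ p : ℝ × ℝ, p.1 ≠ p.2 → ∫ x, ‖g (p, x)‖ = ‖C * (P p + P p.swap)‖ := by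
    intro p hp
    simp only [hg]
    simp_rw [norm_mul (w p.1 * w p.2),
      Real.norm_of_nonneg (mul_nonneg (mlK_nonneg a _) (mlK_nonneg a _))]
    rw [integral_const_mul, (mlK_conv ha ha1 hp).2, h2a]
    simp only [hP, Prod.fst_swap, Prod.snd_swap]
    have e : C * (w p.1 * (w p.2 * mlK γ (p.1 - p.2)) + w p.2 * (w p.1 * mlK γ (p.2 - p.1))) =
      (w p.1 * w p.2) * (C * (mlK γ (p.1 - p.2) + mlK γ (p.2 - p.1))) := by ring
    rw [e, norm_mul (w p.1 * w p.2), Real.norm_of_nonneg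
      (mul_nonneg hCpos.le (add_nonneg (mlK_nonneg γ _) (mlK_nonneg γ _)))]
  have hgi : Integrable g ((volume.prod volume).prod volume) := by
    rw [integrable_prod_iff hgm.aestronglyMeasurable]
    refine ⟨?_, ?_⟩
    · filter_upwards [ml_ae_ne] with p hp
      exact (mlK_conv ha ha1 hp).1.const_mul (w p.1 * w p.2)
    · refine (((hPi.add hPs).const_mul C).norm).congr ?_
      filter_upwards [ml_ae_ne] with p hp
      rw [hgnorm p hp]; rfl
  have hI1 : ∫ q, g q ∂((volume.prod volume).prod volume) =
      C * (2 * ∫ p, P p ∂(volume.prod volume)) := by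
    rw [integral_prod _ hgi]
    have : ∀ᵐ p : ℝ × ℝ ∂(volume.prod volume), ∫ x, g (p, x) = C * (P p + P p.swap) := by
      filter_upwards [ml_ae_ne] with p hp
      exact hgint p hp
    rw [integral_congr_ae this, integral_const_mul, integral_add hPi hPs, integral_prod_swap]
    ring
  have hI2 : 0 ≤ ∫ q, g q ∂((volume.prod volume).prod volume) := by
    rw [integral_prod_symm _ hgi]
    apply integral_nonneg
    intro x
    simp only [hg, Pi.zero_apply]
    have e : ∀ p : ℝ × ℝ, (w p.1 * w p.2) * (mlK a (x - p.1) * mlK a (x - p.2)) =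
      (w p.1 * mlK a (x - p.1)) * (w p.2 * mlK a (x - p.2)) := fun p => by ring
    simp_rw [e]
    rw [integral_prod_mul (fun t => w t * mlK a (x - t)) (fun t => w t * mlK a (x - t))]
    exact mul_self_nonneg _
  have hPpos : 0 ≤ ∫ p, P p ∂(volume.prod volume) := by
    rw [hI1] at hI2
    have := (mul_nonneg_iff_of_pos_left hCpos).1 hI2
    linarith
  have hsec : ∀ t, ∫ r, P (t, r) =
      (Ioc 0 T).indicator (fun t => u t * ∫ r in (0:ℝ)..t, (t - r) ^ (γ - 1) * u r) t := by
    intro t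
    simp only [hP]
    rw [integral_const_mul]
    by_cases ht : t ∈ Ioc 0 T
    · rw [indicator_of_mem ht, hw, indicator_of_mem ht]
      congr 1
      rw [intervalIntegral.integral_of_le ht.1.le, integral_Ioc_eq_integral_Ioo,
        ← integral_indicator measurableSet_Ioo]
      congr 1
      funext r
      by_cases hr : r ∈ Ioo 0 t
      · have hr2 : r ∈ Ioc 0 T := ⟨hr.1, hr.2.le.trans ht.2⟩
        rw [indicator_of_mem hr, indicator_of_mem hr2]
        unfold mlK
        rw [if_pos (sub_pos.2 hr.2), mul_comm]
      · rw [indicator_of_notMem hr]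
        by_cases hr2 : r ∈ Ioc 0 T
        · have : ¬ 0 < t - r := fun h => hr ⟨hr2.1, sub_pos.1 h⟩
          unfold mlK
          rw [if_neg this, mul_zero]
        · rw [indicator_of_notMem hr2, zero_mul]
    · rw [indicator_of_notMem ht, hw, indicator_of_notMem ht, zero_mul]
  refine ⟨?_, ?_⟩
  · rw [intervalIntegrable_iff_integrableOn_Ioc_of_le hT.le, ← integrable_indicator_iff measurableSet_Ioc]
    exact hPi.integral_prod_left.congr (Filter.Eventually.of_forall hsec)
  · rw [intervalIntegral.integral_of_le hT.le, ← integral_indicator measurableSet_Ioc]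
    rw [integral_prod _ hPi] at hPpos
    simp_rw [hsec] at hPpos
    exact hPpos

lemma ml_l1_bound {γ : ℝ} (hγ0 : 0 < γ) (hγ1 : γ < 1) {lam : ℝ} (hlam : lam < 0)
    {T : ℝ} (hT : 0 ≤ T) :
    ∫ t in (0:ℝ)..T, |mittagLeffler γ (lam * t ^ γ)| ≤ T := by
  rcases hT.eq_or_lt with rfl | hT
  · simp
  set u : ℝ → ℝ := fun t => mittagLeffler γ (lam * t ^ γ) with hu
  have huc : Continuous u := by
    have h1 := Real.continuous_rpow_const hγ0.le
    exact (ml_continuous hγ0).comp (continuous_const.mul h1)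
  obtain ⟨hq1, hq2⟩ := ml_quad hγ0 hγ1 huc hT
  set Q : ℝ → ℝ := fun t => u t * ∫ r in (0:ℝ)..t, (t - r) ^ (γ - 1) * u r with hQ
  set c := lam / Real.Gamma γ with hc
  have hcneg : c ≤ 0 := (div_neg_of_neg_of_pos hlam (Real.Gamma_pos_of_pos hγ0)).le
  have h1 : ∫ t in (0:ℝ)..T, u t ^ 2 = (∫ t in (0:ℝ)..T, u t) + c * ∫ t in (0:ℝ)..T, Q t := by
    rw [← intervalIntegral.integral_const_mul, ← intervalIntegral.integral_add
      (huc.intervalIntegrable _ _) (hq1.const_mul c)]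
    rw [intervalIntegral.integral_of_le hT.le, intervalIntegral.integral_of_le hT.le]
    apply setIntegral_congr_fun measurableSet_Ioc
    intro t ht
    have hv := ml_volterra hγ0 lam ht.1
    simp only [hQ]
    change u t = 1 + c * ∫ r in (0:ℝ)..t, (t - r) ^ (γ - 1) * u r at hv
    linear_combination u t * hv
  have h2 : ∫ t in (0:ℝ)..T, u t ^ 2 ≤ ∫ t in (0:ℝ)..T, u t := by
    have := mul_nonpos_of_nonpos_of_nonneg hcneg hq2
    linarith
  have habs : ∫ t in (0:ℝ)..T, |u t| ≤ ∫ t in (0:ℝ)..T, (1 / 2 + 1 / 2 * u t ^ 2) := by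
    apply intervalIntegral.integral_mono_on hT.le
    · exact huc.abs.intervalIntegrable _ _
    · exact Continuous.intervalIntegrable (by fun_prop) _ _
    · intro t _
      nlinarith [sq_nonneg (|u t| - 1), sq_abs (u t)]
  have hle : ∫ t in (0:ℝ)..T, u t ≤ ∫ t in (0:ℝ)..T, |u t| := by
    apply intervalIntegral.integral_mono_on hT.le
    · exact huc.intervalIntegrable _ _
    · exact huc.abs.intervalIntegrable _ _
    · intro t _
      exact le_abs_self _
  have h3 : ∫ t in (0:ℝ)..T, (1 / 2 + 1 / 2 * u t ^ 2) =
      1 / 2 * T + 1 / 2 * ∫ t in (0:ℝ)..T, u t ^ 2 := by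
    rw [intervalIntegral.integral_add (by simp)
      (Continuous.intervalIntegrable (by fun_prop) _ _), intervalIntegral.integral_const_mul]
    simp
    ring
  linarith

lemma ml_integrable_neg {γ : ℝ} (hγ0 : 0 < γ) (hγ1 : γ < 1) {lam : ℝ} (hlam : lam < 0)
    {s : ℝ} (hs : 0 < s) :
    IntegrableOn (fun t => Real.exp (-s * t) * mittagLeffler γ (lam * t ^ γ)) (Ioi 0) := by
  set u : ℝ → ℝ := fun t => mittagLeffler γ (lam * t ^ γ) with hu
  have huc : Continuous u := by
    have h1 := Real.continuous_rpow_const hγ0.le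
    exact (ml_continuous hγ0).comp (continuous_const.mul h1)
  change IntegrableOn (fun t => Real.exp (-s * t) * u t) (Ioi 0)
  refine integrableOn_Ioi_of_intervalIntegral_norm_bounded (l := Filter.atTop) (b := id) (1 / s) 0
    (fun T => ?_) Filter.tendsto_id ?_
  · exact Continuous.integrableOn_Ioc (by fun_prop)
  filter_upwards [Filter.eventually_ge_atTop 0] with T hT
  simp only [id]
  set D : ℝ → ℝ := fun T => ∫ t in (0:ℝ)..T, (1 - |u t|) with hD
  have hcd : Continuous (fun t => 1 - |u t|) := by fun_prop
  have hDd : ∀ x, HasDerivAt D (1 - |u x|) x := fun x =>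
    intervalIntegral.integral_hasDerivAt_right (hcd.intervalIntegrable _ _)
      hcd.stronglyMeasurable.stronglyMeasurableAtFilter hcd.continuousAt
  have hDnn : ∀ x, 0 ≤ x → 0 ≤ D x := by
    intro x hx
    simp only [hD]
    rw [intervalIntegral.integral_sub (by simp) (huc.abs.intervalIntegrable _ _)]
    have := ml_l1_bound hγ0 hγ1 hlam hx
    simp
    linarith
  have hed : ∀ x, HasDerivAt (fun t => Real.exp (-s * t)) (-s * Real.exp (-s * x)) x := by
    intro x
    have := ((hasDerivAt_id x).const_mul (-s)).exp
    simpa [mul_comm] using this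
  have hparts := intervalIntegral.integral_mul_deriv_eq_deriv_mul (a := 0) (b := T)
    (fun x _ => hed x) (fun x _ => hDd x)
    (Continuous.intervalIntegrable (by fun_prop) _ _) (hcd.intervalIntegrable _ _)
  have hneg : ∫ x in (0:ℝ)..T, -s * Real.exp (-s * x) * D x ≤ 0 := by
    have : 0 ≤ ∫ x in (0:ℝ)..T, -(-s * Real.exp (-s * x) * D x) := by
      apply intervalIntegral.integral_nonneg hT
      intro x hx
      have := hDnn x hx.1
      have : 0 ≤ s * Real.exp (-s * x) * D x := by positivity
      linarith
    rw [intervalIntegral.integral_neg] at this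
    linarith
  have hD0 : D 0 = 0 := by simp [hD]
  have hpos : 0 ≤ ∫ x in (0:ℝ)..T, Real.exp (-s * x) * (1 - |u x|) := by
    rw [hparts, hD0]
    have := mul_nonneg (Real.exp_pos (-s * T)).le (hDnn T hT)
    linarith
  have hsplit : ∫ x in (0:ℝ)..T, Real.exp (-s * x) * (1 - |u x|) =
      (∫ x in (0:ℝ)..T, Real.exp (-s * x)) - ∫ x in (0:ℝ)..T, ‖Real.exp (-s * x) * u x‖ := by
    rw [← intervalIntegral.integral_sub (Continuous.intervalIntegrable (by fun_prop) _ _)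
      (Continuous.intervalIntegrable (by fun_prop) _ _)]
    congr 1
    funext x
    rw [norm_mul, Real.norm_of_nonneg (Real.exp_pos _).le, Real.norm_eq_abs]
    ring
  have hexp : ∫ x in (0:ℝ)..T, Real.exp (-s * x) ≤ 1 / s := by
    have h := intervalIntegral.integral_eq_sub_of_hasDerivAt (a := 0) (b := T)
      (f := fun t => -(1 / s) * Real.exp (-s * t)) (f' := fun t => Real.exp (-s * t))
      (fun x _ => by
        have := (hed x).const_mul (-(1 / s))
        convert! this using 1
        field_simp) (Continuous.intervalIntegrable (by fun_prop) _ _)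
    rw [h]
    have : 0 < 1 / s * Real.exp (-s * T) := by positivity
    simp
    simp at this
    exact this.le
  linarith

lemma ml_laplace_neg {γ : ℝ} (hγ0 : 0 < γ) (hγ1 : γ < 1) {lam : ℝ} (hlam : lam < 0)
    {s : ℝ} (hs : 0 < s) :
    ∫ t in Ioi (0:ℝ), Real.exp (-s * t) * mittagLeffler γ (lam * t ^ γ) =
      s ^ (γ - 1) / (s ^ γ - lam) := by
  have hf := ml_integrable_neg hγ0 hγ1 hlam hs
  have hGpos := Real.Gamma_pos_of_pos hγ0
  have hsγ : 0 < s ^ γ := by positivity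
  have hgval := Real.integral_rpow_mul_exp_neg_mul_Ioi hγ0 hs
  have hg : IntegrableOn (fun t : ℝ => t ^ (γ - 1) * Real.exp (-(s * t))) (Ioi 0) := by
    apply not_imp_comm.1 integral_undef
    rw [hgval]; positivity
  have hconv := integral_posConvolution hf hg (ContinuousLinearMap.mul ℝ ℝ)
  simp only [ContinuousLinearMap.mul_apply'] at hconv
  rw [hgval] at hconv
  set I := ∫ t in Ioi (0:ℝ), Real.exp (-s * t) * mittagLeffler γ (lam * t ^ γ) with hI
  have hone : ∫ t in Ioi (0:ℝ), Real.exp (-s * t) = 1 / s := by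
    rw [integral_exp_mul_Ioi (by linarith)]
    simp
  have honei : IntegrableOn (fun t => Real.exp (-s * t)) (Ioi 0) := by
    apply not_imp_comm.1 integral_undef
    rw [hone]; positivity
  have hinner : ∀ t ∈ Ioi (0:ℝ), ∫ r in (0:ℝ)..t, Real.exp (-s * r) * mittagLeffler γ (lam * r ^ γ) *
      ((t - r) ^ (γ - 1) * Real.exp (-(s * (t - r)))) =
      Real.Gamma γ / lam * (Real.exp (-s * t) * mittagLeffler γ (lam * t ^ γ) - Real.exp (-s * t)) := by
    intro t ht
    have e : ∀ r, Real.exp (-s * r) * mittagLeffler γ (lam * r ^ γ) *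
      ((t - r) ^ (γ - 1) * Real.exp (-(s * (t - r)))) =
      Real.exp (-s * t) * ((t - r) ^ (γ - 1) * mittagLeffler γ (lam * r ^ γ)) := by
      intro r
      have : Real.exp (-s * t) = Real.exp (-s * r) * Real.exp (-(s * (t - r))) := by
        rw [← Real.exp_add]; congr 1; ring
      rw [this]; ring
    simp_rw [e]
    rw [intervalIntegral.integral_const_mul, ml_volterra hγ0 lam ht]
    have := hlam.ne
    field_simp
    ring
  rw [setIntegral_congr_fun measurableSet_Ioi hinner, integral_const_mul,
    integral_sub hf honei, hone, ← hI, Real.div_rpow zero_le_one hs.le, Real.one_rpow] at hconv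
  rw [Real.rpow_sub hs, Real.rpow_one]
  have h1 : s ^ γ - lam ≠ 0 := by linarith
  have h2 := hlam.ne
  field_simp at hconv
  field_simp
  linear_combination hconv

/-- Laplace transform of the Mittag-Leffler function: for `0 < γ < 1`, `λ ∈ ℝ`
and real `s > 0` with `s^γ > λ`, the function `t ↦ e^{−st} E_γ(λ t^γ)` is integrable
on `(0,∞)` and `∫_0^∞ e^{−st} E_γ(λ t^γ) dt = s^{γ−1}/(s^γ − λ)`. -/
theorem laplace_transform_mittagLeffler
    (γ : ℝ) (hγ0 : 0 < γ) (hγ1 : γ < 1) (lam : ℝ)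
    (s : ℝ) (hs : 0 < s) (hslam : lam < s ^ γ) :
    IntegrableOn (fun t => Real.exp (-s * t) * mittagLeffler γ (lam * t ^ γ)) (Ioi 0) ∧
    ∫ t in Ioi (0:ℝ), Real.exp (-s * t) * mittagLeffler γ (lam * t ^ γ) =
      s ^ (γ - 1) / (s ^ γ - lam) := by
  have hval : ∫ t in Ioi (0:ℝ), Real.exp (-s * t) * mittagLeffler γ (lam * t ^ γ) =
      s ^ (γ - 1) / (s ^ γ - lam) := by
    rcases lt_or_ge lam 0 with h | h
    · exact ml_laplace_neg hγ0 hγ1 h hs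
    · exact ml_laplace_nonneg hγ0 h hs hslam
  refine ⟨?_, hval⟩
  apply not_imp_comm.1 integral_undef
  rw [hval]
  have : 0 < s ^ γ - lam := by linarith
  positivity
end

section
/- (Blow-up alternative.) Let 0 < γ < 1 and v₀ ∈ ℝ. Suppose f : [0, ∞) × ℝ → ℝ is continuous and for every A > 0 and M > 0 there is L_{A,M} > 0 with sup_{0≤t≤A} |f(t, v₁) − f(t, v₂)| ≤ L_{A,M} |v₁ − v₂| for all v₁, v₂ ∈ [−M, M]. Then either there exists a continuous function v : [0, ∞) → ℝ satisfying v(t) = v₀ + (1/Γ(γ)) ∫_0^t (t−s)^{γ−1} f(s, v(s)) ds for all t ≥ 0, or there exists T_b ∈ (0, ∞) and a continuous function v : [0, T_b) → ℝ satisfying this integral equation on [0, T_b) with limsup_{t→T_b⁻} |v(t)| = ∞. -/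
open MeasureTheory Set Filter
open scoped ENNReal Topology

lemma kerInt (γ : ℝ) (hγ0 : 0 < γ) (t : ℝ) :
    IntervalIntegrable (fun s : ℝ => (t - s) ^ (γ - 1)) volume 0 t := by
  have h := (intervalIntegral.intervalIntegrable_rpow' (a := 0) (b := t) (r := γ - 1) (by linarith)).comp_sub_left t
  simpa using h.symm

lemma kerInt_mul (γ : ℝ) (hγ0 : 0 < γ) (t : ℝ) (ht : 0 ≤ t) (g : ℝ → ℝ)
    (hg : ContinuousOn g (Icc 0 t)) :
    IntervalIntegrable (fun s : ℝ => (t - s) ^ (γ - 1) * g s) volume 0 t :=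
  (kerInt γ hγ0 t).mul_continuousOn (by rwa [uIcc_of_le ht])

lemma kerBound (γ : ℝ) (hγ0 : 0 < γ) (l : ℝ) (hl : 0 < l) (D : ℝ) (hD : 0 ≤ D) (t : ℝ)
    (ht : 0 ≤ t) (h : ℝ → ℝ) (hh : ∀ s ∈ Icc 0 t, |h s| ≤ D * Real.exp (l * s)) :
    |∫ s in (0:ℝ)..t, (t - s) ^ (γ - 1) * h s| ≤
      D * (Real.Gamma γ * (1 / l) ^ γ) * Real.exp (l * t) := by
  have h1 : |∫ s in (0:ℝ)..t, (t - s) ^ (γ - 1) * h s| ≤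
      ∫ s in (0:ℝ)..t, (t - s) ^ (γ - 1) * (D * Real.exp (l * s)) := by
    rw [← Real.norm_eq_abs]
    apply intervalIntegral.norm_integral_le_of_norm_le ht
    · filter_upwards with s hs
      have : 0 ≤ (t - s) ^ (γ - 1) := Real.rpow_nonneg (by linarith [hs.2]) _
      rw [norm_mul, Real.norm_eq_abs, Real.norm_eq_abs, abs_of_nonneg this]
      exact mul_le_mul_of_nonneg_left (hh s ⟨hs.1.le, hs.2⟩) this
    · exact kerInt_mul γ hγ0 t ht _ (by fun_prop)
  refine h1.trans ?_
  have h2 : ∫ s in (0:ℝ)..t, (t - s) ^ (γ - 1) * (D * Real.exp (l * s)) =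
      D * Real.exp (l * t) * ∫ r in (0:ℝ)..t, r ^ (γ - 1) * Real.exp (-(l * r)) := by
    have := intervalIntegral.integral_comp_sub_left (a := 0) (b := t)
      (fun r : ℝ => D * Real.exp (l * t) * (r ^ (γ - 1) * Real.exp (-(l * r)))) t
    rw [sub_self, sub_zero] at this
    rw [← intervalIntegral.integral_const_mul, ← this]
    congr 1; ext s
    have : Real.exp (l * s) = Real.exp (l * t) * Real.exp (-(l * (t - s))) := by
      rw [← Real.exp_add]; congr 1; ring
    rw [this]; ring
  have h3 : ∫ r in (0:ℝ)..t, r ^ (γ - 1) * Real.exp (-(l * r)) ≤ (1 / l) ^ γ * Real.Gamma γ := by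
    rw [← Real.integral_rpow_mul_exp_neg_mul_Ioi hγ0 hl, intervalIntegral.integral_of_le ht]
    apply setIntegral_mono_set
    · have := integrableOn_rpow_mul_exp_neg_mul_rpow (p := 1) (s := γ - 1) (b := l) (by linarith) one_pos hl
      simpa using this
    · filter_upwards [ae_restrict_mem measurableSet_Ioi] with r hr
      have : (0:ℝ) < r := hr
      simp only [Pi.zero_apply]
      positivity
    · exact (Ioc_subset_Ioi_self).eventuallyLE
  rw [h2]
  have := mul_le_mul_of_nonneg_left h3 (show 0 ≤ D * Real.exp (l * t) by positivity)
  linarith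

lemma ker_scale (γ : ℝ) (t : ℝ) (ht : 0 ≤ t) (hγ0 : 0 < γ) (g : ℝ → ℝ) :
    ∫ s in (0:ℝ)..t, (t - s) ^ (γ - 1) * g s =
      t ^ γ * ∫ x in (0:ℝ)..1, (1 - x) ^ (γ - 1) * g (t * x) := by
  have := intervalIntegral.mul_integral_comp_mul_left (a := 0) (b := 1)
      (f := fun s : ℝ => (t - s) ^ (γ - 1) * g s) t
  rw [mul_zero, mul_one] at this
  rw [← this]
  rcases ht.eq_or_lt with h0 | h0
  · rw [← h0, Real.zero_rpow hγ0.ne']; simp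
  have e : t ^ γ = t * t ^ (γ - 1) := by
    rw [Real.rpow_sub_one h0.ne']; field_simp
  rw [e, mul_assoc]
  congr 1
  rw [← intervalIntegral.integral_const_mul]
  apply intervalIntegral.integral_congr
  intro x hx
  rw [uIcc_of_le zero_le_one] at hx
  simp only
  rw [show t - t * x = t * (1 - x) by ring, Real.mul_rpow ht (by linarith [hx.2])]
  ring

lemma ker_cont (γ : ℝ) (hγ0 : 0 < γ) (g : ℝ → ℝ) (hg : Continuous g) (B : ℝ)
    (hB : ∀ s, |g s| ≤ B) :
    Continuous (fun t : ℝ => ∫ s in (0:ℝ)..(max t 0), (max t 0 - s) ^ (γ - 1) * g s) := by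
  have : (fun t : ℝ => ∫ s in (0:ℝ)..(max t 0), (max t 0 - s) ^ (γ - 1) * g s) =
     fun t => (max t 0) ^ γ * ∫ x in (0:ℝ)..1, (1 - x) ^ (γ - 1) * g (max t 0 * x) := by
    ext t; exact ker_scale γ _ (le_max_right _ _) hγ0 g
  rw [this]
  apply Continuous.mul
  · exact (by fun_prop : Continuous fun t : ℝ => max t 0).rpow_const (fun _ => Or.inr hγ0.le)
  · apply intervalIntegral.continuous_of_dominated_interval
      (bound := fun x : ℝ => (1 - x) ^ (γ - 1) * B)
    · intro t
      exact (kerInt_mul γ hγ0 1 zero_le_one (fun x => g (max t 0 * x)) (by fun_prop)).aestronglyMeasurable_restrict_uIoc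
    · intro t
      filter_upwards with x hx
      rw [uIoc_of_le zero_le_one] at hx
      have : 0 ≤ (1 - x) ^ (γ - 1) := Real.rpow_nonneg (by linarith [hx.2]) _
      rw [norm_mul, Real.norm_eq_abs, Real.norm_eq_abs, abs_of_nonneg this]
      exact mul_le_mul_of_nonneg_left (hB _) this
    · exact kerInt_mul γ hγ0 1 zero_le_one _ (by fun_prop)
    · filter_upwards with x hx
      fun_prop

lemma choose_l (γ : ℝ) (hγ0 : 0 < γ) (L : ℝ) (hL : 0 < L) :
    ∃ l > 0, L * (1 / l) ^ γ ≤ 1 / 2 := by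
  refine ⟨(2 * L) ^ (1 / γ), by positivity, ?_⟩
  rw [Real.div_rpow zero_le_one (by positivity), ← Real.rpow_mul (by positivity),
    one_div_mul_cancel hγ0.ne', Real.one_rpow, Real.rpow_one]
  apply le_of_eq; field_simp

open BoundedContinuousFunction in
lemma exist_lip (γ : ℝ) (hγ0 : 0 < γ) (v₀ : ℝ) (F : ℝ → ℝ → ℝ)
    (hF : Continuous (fun p : ℝ × ℝ => F p.1 p.2)) (B : ℝ) (hB : ∀ s x, |F s x| ≤ B)
    (L : ℝ) (hL : 0 < L) (hlip : ∀ s x y, |F s x - F s y| ≤ L * |x - y|) :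
    ∃ u : ℝ → ℝ, Continuous u ∧ ∀ t, 0 ≤ t → u t = v₀ + (1 / Real.Gamma γ) *
          ∫ s in (0:ℝ)..t, (t - s) ^ (γ - 1) * F s (u s) := by
  obtain ⟨l, hl, hlL⟩ := choose_l γ hγ0 L hL
  have hG := Real.Gamma_pos_of_pos hγ0
  have hB0 : 0 ≤ B := (abs_nonneg _).trans (hB 0 0)
  have hc : ∀ w : ℝ →ᵇ ℝ, Continuous fun s => F s (Real.exp (l * s) * w s) := fun w =>
    hF.comp (by fun_prop : Continuous fun s => (s, Real.exp (l * s) * w s))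
  let P : (ℝ →ᵇ ℝ) → ℝ → ℝ := fun w t => Real.exp (-(l * max t 0)) * (v₀ + (1 / Real.Gamma γ) *
    ∫ s in (0:ℝ)..(max t 0), (max t 0 - s) ^ (γ - 1) * F s (Real.exp (l * s) * w s))
  have hPc : ∀ w, Continuous (P w) := by
    intro w
    have := ker_cont γ hγ0 _ (hc w) B (fun s => hB _ _)
    fun_prop
  have hPb : ∀ w t, ‖P w t‖ ≤ |v₀| + B * (1 / l) ^ γ := by
    intro w t
    have ht : 0 ≤ max t 0 := le_max_right _ _
    have h1 := kerBound γ hγ0 l hl B hB0 (max t 0) ht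
      (fun s => F s (Real.exp (l * s) * w s)) (by
        intro s hs
        refine (hB _ _).trans (le_mul_of_one_le_right hB0 (Real.one_le_exp (by have := hs.1; positivity))))
    simp only [P]
    set I := ∫ s in (0:ℝ)..(max t 0), (max t 0 - s) ^ (γ - 1) * F s (Real.exp (l * s) * w s)
    have h2 : |1 / Real.Gamma γ * I| ≤ B * (1 / l) ^ γ * Real.exp (l * max t 0) := by
      rw [abs_mul, abs_of_pos (by positivity), one_div_mul_eq_div, div_le_iff₀ hG]
      linarith
    have h3 : |v₀ + 1 / Real.Gamma γ * I| ≤ (|v₀| + B * (1 / l) ^ γ) * Real.exp (l * max t 0) := by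
      have : 1 ≤ Real.exp (l * max t 0) := Real.one_le_exp (by positivity)
      have := le_mul_of_one_le_right (abs_nonneg v₀) this
      linarith [abs_add_le v₀ (1 / Real.Gamma γ * I)]
    rw [Real.norm_eq_abs, abs_mul, abs_of_pos (Real.exp_pos _), Real.exp_neg, inv_mul_le_iff₀ (Real.exp_pos _)]
    linarith
  let Φ : (ℝ →ᵇ ℝ) → (ℝ →ᵇ ℝ) := fun w => ofNormedAddCommGroup (P w) (hPc w) _ (hPb w)
  have hΦ : ContractingWith (1/2) Φ := by
    refine ⟨by rw [← NNReal.coe_lt_coe]; norm_num, LipschitzWith.of_dist_le_mul fun w z => ?_⟩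
    rw [BoundedContinuousFunction.dist_le (by positivity)]
    intro t
    have ht : 0 ≤ max t 0 := le_max_right _ _
    change dist (P w t) (P z t) ≤ _
    have h1 := kerBound γ hγ0 l hl (L * dist w z) (by positivity) (max t 0) ht
      (fun s => F s (Real.exp (l * s) * w s) - F s (Real.exp (l * s) * z s)) (by
        intro s hs
        refine (hlip _ _ _).trans ?_
        rw [← mul_sub, abs_mul, abs_of_pos (Real.exp_pos _), mul_assoc, mul_comm (dist w z)]
        have := w.dist_coe_le_dist (g := z) s
        rw [Real.dist_eq] at this
        gcongr)
    simp only [mul_sub] at h1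
    rw [intervalIntegral.integral_sub (kerInt_mul γ hγ0 _ ht _ (hc w).continuousOn)
      (kerInt_mul γ hγ0 _ ht _ (hc z).continuousOn)] at h1
    simp only [P]
    rw [Real.dist_eq]
    set I := ∫ s in (0:ℝ)..(max t 0), (max t 0 - s) ^ (γ - 1) * F s (Real.exp (l * s) * w s)
    set J := ∫ s in (0:ℝ)..(max t 0), (max t 0 - s) ^ (γ - 1) * F s (Real.exp (l * s) * z s)
    rw [← mul_sub, add_sub_add_left_eq_sub, ← mul_sub, abs_mul, abs_of_pos (Real.exp_pos _), Real.exp_neg,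
      inv_mul_le_iff₀ (Real.exp_pos _), abs_mul, abs_of_pos (by positivity), one_div_mul_eq_div,
      div_le_iff₀ hG]
    refine h1.trans ?_
    have : L * (1 / l) ^ γ * (dist w z * Real.Gamma γ * Real.exp (l * max t 0)) ≤
      1 / 2 * (dist w z * Real.Gamma γ * Real.exp (l * max t 0)) := by gcongr
    push_cast
    linarith
  have hfix := hΦ.fixedPoint_isFixedPt
  set w := hΦ.fixedPoint
  refine ⟨fun t => Real.exp (l * t) * w t, by fun_prop, ?_⟩
  intro t ht
  have h1 : P w t = w t := congrArg (fun q : ℝ →ᵇ ℝ => q t) hfix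
  simp only
  rw [← h1]
  simp only [P]
  rw [max_eq_left ht, ← mul_assoc, ← Real.exp_add, add_neg_cancel, Real.exp_zero, one_mul]

lemma uniq (γ : ℝ) (hγ0 : 0 < γ) (v₀ : ℝ) (f : ℝ → ℝ → ℝ)
    (hfc : ContinuousOn (fun p : ℝ × ℝ => f p.1 p.2) (Ici 0 ×ˢ univ))
    (A M L : ℝ) (hA : 0 ≤ A) (hL : 0 < L) (hlip : ∀ t ∈ Icc (0:ℝ) A,
      ∀ v₁ ∈ Icc (-M) M, ∀ v₂ ∈ Icc (-M) M, |f t v₁ - f t v₂| ≤ L * |v₁ - v₂|)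
    (u v : ℝ → ℝ) (hu : Continuous u) (hv : Continuous v)
    (hus : ∀ t ∈ Icc 0 A, u t = v₀ + (1 / Real.Gamma γ) *
          ∫ s in (0:ℝ)..t, (t - s) ^ (γ - 1) * f s (u s))
    (hvs : ∀ t ∈ Icc 0 A, v t = v₀ + (1 / Real.Gamma γ) *
          ∫ s in (0:ℝ)..t, (t - s) ^ (γ - 1) * f s (v s))
    (hub : ∀ t ∈ Icc 0 A, |u t| ≤ M) (hvb : ∀ t ∈ Icc 0 A, |v t| ≤ M) :
    ∀ t ∈ Icc 0 A, u t = v t := by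
  obtain ⟨l, hl, hlL⟩ := choose_l γ hγ0 L hL
  have hG := Real.Gamma_pos_of_pos hγ0
  obtain ⟨t, ht, hmax⟩ := isCompact_Icc.exists_isMaxOn (nonempty_Icc.2 hA)
    (f := fun t => Real.exp (-(l * t)) * |u t - v t|) (by fun_prop)
  set D := Real.exp (-(l * t)) * |u t - v t| with hDdef
  have hD : 0 ≤ D := by positivity
  have hle : ∀ s ∈ Icc 0 A, |u s - v s| ≤ D * Real.exp (l * s) := by
    intro s hs
    have : Real.exp (-(l * s)) * |u s - v s| ≤ D := hmax hs
    rw [Real.exp_neg, inv_mul_le_iff₀ (Real.exp_pos _)] at this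
    linarith
  have hcc : ∀ w : ℝ → ℝ, Continuous w → ContinuousOn (fun s => f s (w s)) (Icc 0 t) := by
    intro w hw
    exact hfc.comp (f := fun s => (s, w s)) (by fun_prop) (fun s hs => ⟨hs.1, trivial⟩)
  have h1 := kerBound γ hγ0 l hl (L * D) (by positivity) t ht.1
      (fun s => f s (u s) - f s (v s)) (by
        intro s hs
        have hs' : s ∈ Icc 0 A := ⟨hs.1, hs.2.trans ht.2⟩
        refine (hlip s hs' _ (abs_le.1 (hub s hs')) _ (abs_le.1 (hvb s hs'))).trans ?_
        rw [mul_assoc]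
        exact mul_le_mul_of_nonneg_left (hle s hs') hL.le)
  simp only [mul_sub] at h1
  rw [intervalIntegral.integral_sub (kerInt_mul γ hγ0 _ ht.1 _ (hcc u hu))
      (kerInt_mul γ hγ0 _ ht.1 _ (hcc v hv))] at h1
  have h2 : |u t - v t| ≤ L * D * (1 / l) ^ γ * Real.exp (l * t) := by
    rw [hus t ht, hvs t ht, add_sub_add_left_eq_sub, ← mul_sub, abs_mul, abs_of_pos (by positivity),
      one_div_mul_eq_div, div_le_iff₀ hG]
    linarith
  have h3 : D ≤ L * D * (1 / l) ^ γ := by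
    rw [hDdef, Real.exp_neg, inv_mul_le_iff₀ (Real.exp_pos _), ← Real.exp_neg, ← hDdef]
    linarith
  have h4 : D = 0 := by nlinarith
  intro s hs
  have := hle s hs
  rw [h4, zero_mul] at this
  exact sub_eq_zero.1 (abs_eq_zero.1 (le_antisymm this (abs_nonneg _)))

/-- truncated solution -/
lemma trunc (γ : ℝ) (hγ0 : 0 < γ) (v₀ : ℝ)
    (f : ℝ → ℝ → ℝ)
    (hfc : ContinuousOn (fun p : ℝ × ℝ => f p.1 p.2) (Ici 0 ×ˢ univ))
    (hlip : ∀ A > (0:ℝ), ∀ M > (0:ℝ), ∃ L > (0:ℝ), ∀ t ∈ Icc (0:ℝ) A,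
      ∀ v₁ ∈ Icc (-M) M, ∀ v₂ ∈ Icc (-M) M, |f t v₁ - f t v₂| ≤ L * |v₁ - v₂|)
    (R : ℝ) (hR : |v₀| < R) :
    ∃ u : ℝ → ℝ, ∃ T : ℝ, Continuous u ∧ 0 ≤ T ∧ T ≤ R ∧
      (∀ t ∈ Icc 0 T, u t = v₀ + (1 / Real.Gamma γ) *
          ∫ s in (0:ℝ)..t, (t - s) ^ (γ - 1) * f s (u s)) ∧
      (∀ t ∈ Icc 0 T, |u t| ≤ R) ∧ (T < R → |u T| = R) := by
  have hR0 : 0 < R := (abs_nonneg _).trans_lt hR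
  obtain ⟨L, hL, hLip⟩ := hlip R hR0 R hR0
  let ct : ℝ → ℝ := fun t => max 0 (min R t)
  let cv : ℝ → ℝ := fun t => max (-R) (min R t)
  have hct : ∀ t, ct t ∈ Icc 0 R := fun t => ⟨le_max_left _ _, max_le hR0.le (min_le_left _ _)⟩
  have hcv : ∀ t, cv t ∈ Icc (-R) R := fun t => ⟨le_max_left _ _, max_le (by linarith) (min_le_left _ _)⟩
  have hF : Continuous (fun p : ℝ × ℝ => f (ct p.1) (cv p.2)) := 
    hfc.comp_continuous (f := fun p : ℝ × ℝ => (ct p.1, cv p.2)) (by fun_prop) (fun p => ⟨(hct _).1, trivial⟩)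
  obtain ⟨B, hB⟩ := ((isCompact_Icc (a := (0:ℝ)) (b := R)).prod (isCompact_Icc (a := -R) (b := R))).exists_bound_of_continuousOn
    (hfc.mono (prod_mono Icc_subset_Ici_self (subset_univ _)))
  obtain ⟨u, huc, hu⟩ := exist_lip γ hγ0 v₀ (fun t x => f (ct t) (cv x)) hF B
    (fun s x => hB (ct s, cv x) ⟨hct _, hcv _⟩) L hL (by
      intro s x y
      refine (hLip _ (hct _) _ (hcv _) _ (hcv _)).trans ?_
      refine mul_le_mul_of_nonneg_left ?_ hL.le
      simp only [cv]
      refine (abs_max_sub_max_le_max _ _ _ _).trans ?_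
      rw [sub_self, abs_zero, max_eq_right (abs_nonneg _)]
      refine (abs_min_sub_min_le_max _ _ _ _).trans ?_
      rw [sub_self, abs_zero, max_eq_right (abs_nonneg _)])
  have hu0 : u 0 = v₀ := by rw [hu 0 le_rfl]; simp
  -- the exit time
  have key : ∃ T, 0 ≤ T ∧ T ≤ R ∧ (∀ t ∈ Icc 0 T, |u t| ≤ R) ∧ (T < R → |u T| = R) := by
    by_cases h : ∀ t ∈ Icc 0 R, |u t| < R
    · exact ⟨R, hR0.le, le_rfl, fun t ht => (h t ht).le, fun h => absurd h (lt_irrefl _)⟩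
    push Not at h
    let S := Icc 0 R ∩ {t | R ≤ |u t|}
    have hS : IsCompact S := isCompact_Icc.inter_right (isClosed_le continuous_const (by fun_prop))
    have hne : S.Nonempty := by obtain ⟨t, h1, h2⟩ := h; exact ⟨t, h1, h2⟩
    obtain ⟨T, hT, hmin⟩ := hS.exists_isLeast hne
    have hlt : ∀ t ∈ Ico 0 T, |u t| < R := by
      intro t ht
      by_contra hcon
      exact absurd (hmin ⟨⟨ht.1, ht.2.le.trans hT.1.2⟩, not_lt.1 hcon⟩) (not_le.2 ht.2)
    have hT0 : 0 < T := by
      rcases hT.1.1.eq_or_lt with h | h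
      · have := hT.2
        rw [← h] at this
        simp only [mem_ofPred_eq, hu0] at this
        linarith
      · exact h
    have hle : ∀ t ∈ Icc 0 T, |u t| ≤ R := by
      have : IsClosed {t | |u t| ≤ R} := isClosed_le (by fun_prop) continuous_const
      have h2 := this.closure_subset_iff.2 (fun t ht => (hlt t ht).le : Ico 0 T ⊆ _)
      rw [closure_Ico hT0.ne] at h2
      exact h2
    exact ⟨T, hT.1.1, hT.1.2, hle, fun _ => le_antisymm (hle T ⟨hT.1.1, le_rfl⟩) hT.2⟩
  obtain ⟨T, h0, h1, h2, h3⟩ := key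
  refine ⟨u, T, huc, h0, h1, ?_, h2, h3⟩
  intro t ht
  refine (hu t ht.1).trans ?_
  congr 2
  apply intervalIntegral.integral_congr
  intro s hs
  rw [uIcc_of_le ht.1] at hs
  have hs' : s ∈ Icc 0 T := ⟨hs.1, hs.2.trans ht.2⟩
  have e1 : ct s = s := by
    simp only [ct]; rw [min_eq_right (hs'.2.trans h1), max_eq_right hs.1]
  have e2 : cv (u s) = u s := by
    have := abs_le.1 (h2 s hs')
    simp only [cv]; rw [min_eq_right this.2, max_eq_right this.1]
  simp only [e1, e2]

/-- Blow-up alternative for the fractional ODE `D_c^γ v = f(t,v)`, `v(0) = v₀`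
(`0 < γ < 1`), with `f : [0,∞) × ℝ → ℝ` continuous and locally Lipschitz in `v`:
either there is a global continuous solution of the Volterra integral equation on
`[0,∞)`, or there are `T_b ∈ (0,∞)` and a continuous solution `v` on `[0, T_b)` with
`limsup_{t→T_b⁻} |v(t)| = ∞`. -/
theorem fode_blowup_alternative
    (γ : ℝ) (hγ0 : 0 < γ) (hγ1 : γ < 1) (v₀ : ℝ)
    (f : ℝ → ℝ → ℝ)
    (hfc : ContinuousOn (fun p : ℝ × ℝ => f p.1 p.2) (Ici 0 ×ˢ univ))
    (hlip : ∀ A > (0:ℝ), ∀ M > (0:ℝ), ∃ L > (0:ℝ), ∀ t ∈ Icc (0:ℝ) A,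
      ∀ v₁ ∈ Icc (-M) M, ∀ v₂ ∈ Icc (-M) M, |f t v₁ - f t v₂| ≤ L * |v₁ - v₂|) :
    (∃ v : ℝ → ℝ, ContinuousOn v (Ici 0) ∧
      ∀ t : ℝ, 0 ≤ t →
        v t = v₀ + (1 / Real.Gamma γ) *
          ∫ s in (0:ℝ)..t, (t - s) ^ (γ - 1) * f s (v s)) ∨
    (∃ Tb : ℝ, 0 < Tb ∧ ∃ v : ℝ → ℝ,
      ContinuousOn v (Ico 0 Tb) ∧
      (∀ t ∈ Ico (0:ℝ) Tb,
        v t = v₀ + (1 / Real.Gamma γ) *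
          ∫ s in (0:ℝ)..t, (t - s) ^ (γ - 1) * f s (v s)) ∧
      ∀ M : ℝ, ∃ᶠ t in 𝓝[<] Tb, M < |v t|) := by
  classical
  let R : ℕ → ℝ := fun n => |v₀| + 1 + n
  have hRv : ∀ n, |v₀| < R n := fun n => by
    have : (0:ℝ) ≤ n := n.cast_nonneg
    simp only [R]; linarith
  have hRpos : ∀ n, 0 < R n := fun n => (abs_nonneg _).trans_lt (hRv n)
  have hRmono : StrictMono R := fun a b h => by
    have : (a:ℝ) < b := by exact_mod_cast h
    simp only [R]; linarith
  choose u T huc hT0 hTR hus hub hTe using fun n => trunc γ hγ0 v₀ f hfc hlip (R n) (hRv n)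
  have agree' : ∀ n m, n ≤ m → ∀ t, 0 ≤ t → t ≤ T n → t ≤ T m → u n t = u m t := by
    intro n m hnm t ht h1 h2
    obtain ⟨L, hL, hLip⟩ := hlip (R m) (hRpos m) (R m) (hRpos m)
    exact uniq γ hγ0 v₀ f hfc t (R m) L ht hL
      (fun s hs => hLip s ⟨hs.1, hs.2.trans (h2.trans (hTR m))⟩) (u n) (u m) (huc n) (huc m)
      (fun s hs => hus n s ⟨hs.1, hs.2.trans h1⟩) (fun s hs => hus m s ⟨hs.1, hs.2.trans h2⟩)
      (fun s hs => (hub n s ⟨hs.1, hs.2.trans h1⟩).trans (hRmono.monotone hnm))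
      (fun s hs => hub m s ⟨hs.1, hs.2.trans h2⟩) t ⟨ht, le_rfl⟩
  have agree : ∀ n m t, 0 ≤ t → t ≤ T n → t ≤ T m → u n t = u m t := by
    intro n m t ht h1 h2
    rcases le_total n m with h | h
    · exact agree' n m h t ht h1 h2
    · exact (agree' m n h t ht h2 h1).symm
  have hTmono : Monotone T := by
    intro n m hnm
    by_contra hcon
    push Not at hcon
    have h1 : T m < R m := hcon.trans_le ((hTR n).trans (hRmono.monotone hnm))
    have h2 := hTe m h1
    rw [← agree n m (T m) (hT0 m) hcon.le le_rfl] at h2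
    have h3 := hub n (T m) ⟨hT0 m, hcon.le⟩
    rw [h2] at h3
    have := hRmono.le_iff_le.1 h3
    have : n = m := le_antisymm hnm this
    rw [this] at hcon
    exact lt_irrefl _ hcon
  let v : ℝ → ℝ := fun t => if h : ∃ n, t < T n then u h.choose t else 0
  have hv : ∀ n t, 0 ≤ t → t < T n → v t = u n t := by
    intro n t ht h
    have hex : ∃ n, t < T n := ⟨n, h⟩
    simp only [v]
    rw [dif_pos hex]
    exact agree _ _ t ht hex.choose_spec.le h.le
  have hvc : ∀ n t, 0 ≤ t → t < T n → ContinuousWithinAt v (Ici 0) t := by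
    intro n t ht h
    refine (huc n).continuousWithinAt.congr_of_eventuallyEq ?_ (hv n t ht h)
    filter_upwards [self_mem_nhdsWithin, mem_nhdsWithin_of_mem_nhds (Iio_mem_nhds h)] with s hs hs2
    exact hv n s hs hs2
  have hvs : ∀ n t, 0 ≤ t → t < T n → v t = v₀ + (1 / Real.Gamma γ) *
          ∫ s in (0:ℝ)..t, (t - s) ^ (γ - 1) * f s (v s) := by
    intro n t ht h
    rw [hv n t ht h]
    refine (hus n t ⟨ht, h.le⟩).trans ?_
    congr 2
    apply intervalIntegral.integral_congr
    intro s hs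
    rw [uIcc_of_le ht] at hs
    simp only
    rw [hv n s hs.1 (hs.2.trans_lt h)]
  by_cases hbdd : BddAbove (range T)
  · right
    have hlt : ∀ᶠ n in atTop, T n < T (n + 1) ∧ |u n (T n)| = R n := by
      obtain ⟨C, hC⟩ := hbdd
      obtain ⟨N, hN⟩ := exists_nat_gt C
      filter_upwards [eventually_ge_atTop N] with n hn
      have hTlt : ∀ k, n ≤ k → T k < R k := by
        intro k hk
        have h1 : T k ≤ C := hC ⟨k, rfl⟩
        have h2 : (N:ℝ) ≤ k := by exact_mod_cast hn.trans hk
        have h3 := abs_nonneg v₀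
        simp only [R]; linarith
      refine ⟨lt_of_le_of_ne (hTmono n.le_succ) ?_, hTe n (hTlt n le_rfl)⟩
      intro he
      have h1 := hTe n (hTlt n le_rfl)
      have h2 := hTe (n+1) (hTlt _ n.le_succ)
      rw [← he, ← agree n (n+1) (T n) (hT0 n) le_rfl he.le, h1] at h2
      exact (hRmono n.lt_succ_self).ne h2
    have hTle : ∀ n, T n ≤ ⨆ n, T n := fun n => le_ciSup hbdd n
    have htend : Tendsto T atTop (𝓝[<] (⨆ n, T n)) := by
      refine tendsto_nhdsWithin_iff.2 ⟨tendsto_atTop_ciSup hTmono hbdd, ?_⟩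
      filter_upwards [hlt] with n hn
      exact hn.1.trans_le (hTle _)
    have hex : ∀ t, t < (⨆ n, T n) → ∃ n, t < T n := fun t ht => exists_lt_of_lt_ciSup ht
    refine ⟨⨆ n, T n, ?_, v, ?_, ?_, ?_⟩
    · obtain ⟨n, hn⟩ := hlt.exists
      exact (hT0 n).trans_lt (hn.1.trans_le (hTle _))
    · intro t ht
      obtain ⟨n, hn⟩ := hex t ht.2
      exact (hvc n t ht.1 hn).mono Ico_subset_Ici_self
    · intro t ht
      obtain ⟨n, hn⟩ := hex t ht.2
      exact hvs n t ht.1 hn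
    · intro M
      refine htend.frequently (Eventually.frequently ?_)
      obtain ⟨N, hN⟩ := exists_nat_gt M
      filter_upwards [hlt, eventually_ge_atTop N] with n hn hnN
      rw [hv (n+1) (T n) (hT0 n) hn.1, ← agree n (n+1) (T n) (hT0 n) le_rfl hn.1.le, hn.2]
      have h2 : (N:ℝ) ≤ n := by exact_mod_cast hnN
      have h3 := abs_nonneg v₀
      simp only [R]; linarith
  · left
    have hex : ∀ t, ∃ n, t < T n := by
      intro t
      by_contra hcon
      push Not at hcon
      exact hbdd ⟨t, by rintro _ ⟨n, rfl⟩; exact hcon n⟩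
    refine ⟨v, fun t ht => ?_, fun t ht => ?_⟩
    · obtain ⟨n, hn⟩ := hex t
      exact hvc n t ht hn
    · obtain ⟨n, hn⟩ := hex t
      exact hvs n t ht hn
end
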